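/- arXiv:1409.5661 — 2 statements merged into one kernel-verified Lean document; each statement's English description precedes it below -/
import Mathlib

section
/- Let G be a finite simple graph on n vertices and let T be a set of vertices of G such that the induced subgraph of G on the vertex set V(G) ∖ T is triangle-free. Then MIS(G) ≤ 2^{n/2 + |T|/2}. -/
/-- A finset of vertices is independent in `G` if it spans no edges. -/
def IsIndep {V : Type*} (G : SimpleGraph V) (s : Finset V) : Prop :=
  ∀ x ∈ s, ∀ y ∈ s, ¬ G.Adj x y

/-- A maximal independent set: independent, and no outside vertex can be added. -/
def IsMaxIndep {V : Type*} [DecidableEq V] (G : SimpleGraph V) (s : Finset V) : Prop :=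
  IsIndep G s ∧ ∀ v : V, v ∉ s → ¬ IsIndep G (insert v s)

/-- The number of maximal independent sets in `G`. -/
noncomputable def MIS {V : Type*} [DecidableEq V] (G : SimpleGraph V) : ℕ :=
  {s : Finset V | IsMaxIndep G s}.ncard

open Classical in
/-- The maximal independent sets of the subgraph of `G` induced on `W`. -/
noncomputable def maxIndepIn {V : Type*} (G : SimpleGraph V) (W : Finset V) :
    Finset (Finset V) :=
  W.powerset.filter fun s => IsIndep G s ∧ ∀ v ∈ W, v ∉ s → ∃ y ∈ s, G.Adj v y

open Classical in
/-- The closed neighbourhood of `u` within `W`. -/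
noncomputable def closedNbhd {V : Type*} (G : SimpleGraph V) (W : Finset V) (u : V) :
    Finset V :=
  W.filter fun x => x = u ∨ G.Adj u x

section

variable {V : Type*} {G : SimpleGraph V} {W s : Finset V} {u v x : V}

lemma mem_maxIndepIn : s ∈ maxIndepIn G W ↔
    s ⊆ W ∧ IsIndep G s ∧ ∀ v ∈ W, v ∉ s → ∃ y ∈ s, G.Adj v y := by
  simp [maxIndepIn]

lemma mem_closedNbhd : x ∈ closedNbhd G W u ↔ x ∈ W ∧ (x = u ∨ G.Adj u x) := by
  simp [closedNbhd]

lemma closedNbhd_subset : closedNbhd G W u ⊆ W := fun _ hx => (mem_closedNbhd.1 hx).1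

variable [DecidableEq V]

lemma mem_maxIndepIn_erase (hs : s ∈ maxIndepIn G W) (hu : u ∉ s) :
    s ∈ maxIndepIn G (W.erase u) := by
  rw [mem_maxIndepIn] at hs ⊢
  exact ⟨fun x hx => Finset.mem_erase.2 ⟨fun h => hu (h ▸ hx), hs.1 hx⟩, hs.2.1,
    fun v hv => hs.2.2 v (Finset.mem_of_mem_erase hv)⟩

lemma card_filter_notMem_le (G : SimpleGraph V) (W : Finset V) (u : V) :
    ((maxIndepIn G W).filter (u ∉ ·)).card ≤ (maxIndepIn G (W.erase u)).card :=
  Finset.card_le_card fun _ hs =>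
    mem_maxIndepIn_erase (Finset.mem_filter.1 hs).1 (Finset.mem_filter.1 hs).2

lemma card_filter_mem_le (G : SimpleGraph V) (W : Finset V) (u : V) :
    ((maxIndepIn G W).filter (u ∈ ·)).card ≤
      (maxIndepIn G (W \ closedNbhd G W u)).card := by
  refine Finset.card_le_card_of_injOn (fun s => s.erase u) ?_ ?_
  · intro s hs
    obtain ⟨hs, hu⟩ := Finset.mem_filter.1 (Finset.mem_coe.1 hs)
    obtain ⟨hsW, hind, hdom⟩ := mem_maxIndepIn.1 hs
    refine Finset.mem_coe.2 (mem_maxIndepIn.2 ⟨?_, ?_, ?_⟩)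
    · intro x hx
      obtain ⟨hxu, hxs⟩ := Finset.mem_erase.1 hx
      refine Finset.mem_sdiff.2 ⟨hsW hxs, fun h => ?_⟩
      rcases (mem_closedNbhd.1 h).2 with h | h
      · exact hxu h
      · exact hind u hu x hxs h
    · exact fun x hx y hy =>
        hind x (Finset.mem_of_mem_erase hx) y (Finset.mem_of_mem_erase hy)
    · intro v hv hvs
      obtain ⟨hvW, hvN⟩ := Finset.mem_sdiff.1 hv
      have hvu : v ≠ u := fun h => hvN (mem_closedNbhd.2 ⟨hvW, Or.inl h⟩)
      obtain ⟨y, hy, hvy⟩ := hdom v hvW fun h => hvs (Finset.mem_erase.2 ⟨hvu, h⟩)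
      refine ⟨y, Finset.mem_erase.2 ⟨?_, hy⟩, hvy⟩
      rintro rfl
      exact hvN (mem_closedNbhd.2 ⟨hvW, Or.inr hvy.symm⟩)
  · intro s hs t ht hst
    have hs' := (Finset.mem_filter.1 (Finset.mem_coe.1 hs)).2
    have ht' := (Finset.mem_filter.1 (Finset.mem_coe.1 ht)).2
    rw [← Finset.insert_erase hs', ← Finset.insert_erase ht']
    exact congrArg (insert u) hst

lemma card_maxIndepIn_le_add (G : SimpleGraph V) (W : Finset V) (u : V) :
    (maxIndepIn G W).card ≤
      (maxIndepIn G (W \ closedNbhd G W u)).card + (maxIndepIn G (W.erase u)).card := by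
  rw [← Finset.card_filter_add_card_filter_not (s := maxIndepIn G W) (u ∈ ·)]
  exact add_le_add (card_filter_mem_le G W u) (card_filter_notMem_le G W u)

lemma exists_mem_closedNbhd (hs : s ∈ maxIndepIn G W) (hv : v ∈ W) :
    ∃ x ∈ closedNbhd G W v, x ∈ s := by
  obtain ⟨hsW, -, hdom⟩ := mem_maxIndepIn.1 hs
  by_cases h : v ∈ s
  · exact ⟨v, mem_closedNbhd.2 ⟨hv, Or.inl rfl⟩, h⟩
  · obtain ⟨y, hy, hvy⟩ := hdom v hv h
    exact ⟨y, mem_closedNbhd.2 ⟨hsW hy, Or.inr hvy⟩, hy⟩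

lemma card_sdiff_add_card_inter_le (T : Finset V) {Y : Finset V} (hY : Y ⊆ W) :
    (W \ Y).card + ((W \ Y) ∩ T).card + Y.card ≤ W.card + (W ∩ T).card := by
  have h₁ := Finset.card_sdiff_add_card_eq_card hY
  have h₂ : ((W \ Y) ∩ T).card ≤ (W ∩ T).card :=
    Finset.card_le_card (Finset.inter_subset_inter_right Finset.sdiff_subset)
  omega

lemma card_erase_add_card_inter (T : Finset V) (hv : v ∈ W) (hvT : v ∈ T) :
    (W.erase v).card + (W.erase v ∩ T).card + 2 = W.card + (W ∩ T).card := by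
  have h₁ := Finset.card_erase_add_one hv
  have h₂ := Finset.card_erase_add_one (Finset.mem_inter.2 ⟨hv, hvT⟩)
  rw [Finset.erase_inter]
  omega

theorem card_maxIndepIn_le (T : Finset V)
    (hT : ∀ x y z : V, x ∉ T → y ∉ T → z ∉ T →
      G.Adj x y → G.Adj y z → G.Adj x z → False) (k : ℕ) :
    ∀ W : Finset V, W.card + (W ∩ T).card ≤ k →
      ((maxIndepIn G W).card : ℝ) ≤ √2 ^ k := by
  have hr : √2 ^ 2 = (2 : ℝ) := Real.sq_sqrt (by norm_num)
  have hr1 : 1 ≤ √(2 : ℝ) := Real.one_le_sqrt.2 (by norm_num)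
  have hr2 : √(2 : ℝ) ≤ 3 / 2 := Real.sqrt_le_iff.2 ⟨by norm_num, by norm_num⟩
  induction k using Nat.strong_induction_on with
  | _ k ih =>
  intro W hW
  have ih' (m c : ℕ) (hc : 0 < c) (hk : k = m + c) (Y : Finset V) (hY : Y ⊆ W)
      (hcY : c ≤ Y.card) : ((maxIndepIn G (W \ Y)).card : ℝ) ≤ √2 ^ m := by
    have := card_sdiff_add_card_inter_le T hY
    exact ih m (by omega) _ (by omega)
  have hNW (u : V) : (closedNbhd G W u).card ≤ k :=
    (Finset.card_le_card closedNbhd_subset).trans (by omega)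
  have hself {v : V} (hv : v ∈ W) : v ∈ closedNbhd G W v :=
    mem_closedNbhd.2 ⟨hv, Or.inl rfl⟩
  rcases W.eq_empty_or_nonempty with rfl | ⟨v₀, hv₀⟩
  · have h : (maxIndepIn G (∅ : Finset V)).card ≤ 1 := by
      refine Finset.card_le_one.2 fun s hs t ht => ?_
      rw [Finset.subset_empty.1 (mem_maxIndepIn.1 hs).1,
        Finset.subset_empty.1 (mem_maxIndepIn.1 ht).1]
    exact (Nat.cast_le.2 h).trans (by simpa using one_le_pow₀ hr1)
  by_cases hTW : ∃ v ∈ W, v ∈ T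
  · obtain ⟨v, hv, hvT⟩ := hTW
    have hw := card_erase_add_card_inter T hv hvT
    obtain ⟨m, rfl⟩ : ∃ m, k = m + 2 := ⟨k - 2, by omega⟩
    have h₁ := ih m (by omega) (W.erase v) (by omega)
    have hle : W \ closedNbhd G W v ⊆ W.erase v := fun x hx => by
      obtain ⟨hxW, hxN⟩ := Finset.mem_sdiff.1 hx
      exact Finset.mem_erase.2 ⟨fun h => hxN (by rw [h]; exact hself hv), hxW⟩
    have h₂ := ih m (by omega) (W \ closedNbhd G W v) (by
      have := Finset.card_le_card hle
      have := Finset.card_le_card (Finset.inter_subset_inter_right (u := T) hle)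
      omega)
    have h₃ : ((maxIndepIn G W).card : ℝ) ≤ _ :=
      Nat.cast_le.2 (card_maxIndepIn_le_add G W v)
    push_cast at h₃
    rw [pow_add, hr]
    linarith
  by_cases h4 : ∃ v ∈ W, 4 ≤ (closedNbhd G W v).card
  · obtain ⟨v, hv, hcard⟩ := h4
    obtain ⟨m, rfl⟩ : ∃ m, k = m + 4 := ⟨k - 4, by have := hNW v; omega⟩
    have h₁ := ih' m 4 (by norm_num) rfl _ closedNbhd_subset hcard
    have h₂ := ih' (m + 3) 1 (by norm_num) rfl {v} (by simpa using hv) (by simp)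
    rw [← Finset.erase_eq] at h₂
    have h₃ : ((maxIndepIn G W).card : ℝ) ≤ _ :=
      Nat.cast_le.2 (card_maxIndepIn_le_add G W v)
    push_cast at h₃
    have hpos : 0 ≤ √(2 : ℝ) ^ m := by positivity
    have e3 : √(2 : ℝ) ^ (m + 3) = √2 ^ m * (2 * √2) := by
      rw [pow_add, pow_succ _ 2, hr]
    have e4 : √(2 : ℝ) ^ (m + 4) = √2 ^ m * 4 := by
      rw [pow_add, show √(2 : ℝ) ^ 4 = (√2 ^ 2) ^ 2 by ring, hr]; norm_num
    rw [e3] at h₂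
    rw [e4]
    nlinarith
  by_cases h1 : ∃ v ∈ W, (closedNbhd G W v).card ≤ 1
  · obtain ⟨v, hv, hcard⟩ := h1
    have hN : closedNbhd G W v = {v} :=
      (Finset.eq_of_subset_of_card_le (Finset.singleton_subset_iff.2 (hself hv))
        (by simpa using hcard)).symm
    obtain ⟨m, rfl⟩ : ∃ m, k = m + 1 :=
      ⟨k - 1, by have := hNW v; rw [hN, Finset.card_singleton] at this; omega⟩
    have h₁ := ih' m 1 (by norm_num) rfl _ closedNbhd_subset
      (by rw [hN, Finset.card_singleton] : 1 ≤ (closedNbhd G W v).card)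
    have h₂ : (maxIndepIn G W).filter (v ∈ ·) = maxIndepIn G W :=
      Finset.filter_true_of_mem fun s hs => by
        obtain ⟨x, hx, hxs⟩ := exists_mem_closedNbhd hs hv
        rw [hN, Finset.mem_singleton] at hx
        exact hx ▸ hxs
    have h₃ := card_filter_mem_le G W v
    rw [h₂] at h₃
    exact (Nat.cast_le.2 h₃).trans (h₁.trans (pow_le_pow_right₀ hr1 (by omega)))
  push Not at hTW h4 h1
  by_cases h2 : ∃ v ∈ W, (closedNbhd G W v).card = 2
  · obtain ⟨v, hv, hcard⟩ := h2
    obtain ⟨a, b, -, hN⟩ := Finset.card_eq_two.1 hcard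
    have ha : a ∈ W := closedNbhd_subset (u := v) (G := G) (by simp [hN])
    have hb : b ∈ W := closedNbhd_subset (u := v) (G := G) (by simp [hN])
    obtain ⟨m, rfl⟩ : ∃ m, k = m + 2 := ⟨k - 2, by have := hNW v; omega⟩
    have h₁ := ih' m 2 (by norm_num) rfl _ closedNbhd_subset (h1 a ha)
    have h₂ := ih' m 2 (by norm_num) rfl _ closedNbhd_subset (h1 b hb)
    have hsub : maxIndepIn G W ⊆
        (maxIndepIn G W).filter (a ∈ ·) ∪ (maxIndepIn G W).filter (b ∈ ·) := fun s hs => by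
      obtain ⟨x, hx, hxs⟩ := exists_mem_closedNbhd hs hv
      rw [hN, Finset.mem_insert, Finset.mem_singleton] at hx
      rcases hx with rfl | rfl <;> simp [hs, hxs]
    have h₃ : ((maxIndepIn G W).card : ℝ) ≤ _ := Nat.cast_le.2 <|
      (Finset.card_le_card hsub).trans <| (Finset.card_union_le _ _).trans <|
        add_le_add (card_filter_mem_le G W a) (card_filter_mem_le G W b)
    push_cast at h₃
    rw [pow_add, hr]
    linarith
  push Not at h2
  have h3 (v : V) (hv : v ∈ W) : (closedNbhd G W v).card = 3 := by
    have := h4 v hv; have := h1 v hv; have := h2 v hv; omega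
  have hN' : ((closedNbhd G W v₀).erase v₀).card = 2 := by
    rw [Finset.card_erase_of_mem (hself hv₀), h3 v₀ hv₀]
  obtain ⟨a, b, hab, hN⟩ := Finset.card_eq_two.1 hN'
  have hmem (x : V) (hx : x ∈ ({a, b} : Finset V)) : x ∈ W ∧ G.Adj v₀ x := by
    rw [← hN, Finset.mem_erase, mem_closedNbhd] at hx
    exact ⟨hx.2.1, hx.2.2.resolve_left hx.1⟩
  obtain ⟨ha, hva⟩ := hmem a (by simp)
  obtain ⟨hb, hvb⟩ := hmem b (by simp)
  have hnadj : ¬ G.Adj b a := fun h =>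
    hT v₀ b a (hTW v₀ hv₀) (hTW b hb) (hTW a ha) hvb h hva
  have haN : a ∉ closedNbhd G W b := fun h =>
    (mem_closedNbhd.1 h).2.elim hab hnadj
  have hcard : (insert a (closedNbhd G W b)).card = 4 := by
    rw [Finset.card_insert_of_notMem haN, h3 b hb]
  have hsubW : insert a (closedNbhd G W b) ⊆ W :=
    Finset.insert_subset ha closedNbhd_subset
  obtain ⟨m, rfl⟩ : ∃ m, k = m + 4 :=
    ⟨k - 4, by have := Finset.card_le_card hsubW; omega⟩
  have h₁ := ih' (m + 1) 3 (by norm_num) rfl _ closedNbhd_subset (h3 v₀ hv₀).ge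
  have h₂ := ih' (m + 1) 3 (by norm_num) rfl _ closedNbhd_subset (h3 a ha).ge
  have h₃ := ih' m 4 (by norm_num) rfl _ hsubW hcard.ge
  have hsd : W.erase a \ closedNbhd G (W.erase a) b = W \ insert a (closedNbhd G W b) := by
    ext x
    simp only [Finset.mem_sdiff, Finset.mem_erase, Finset.mem_insert, mem_closedNbhd]
    tauto
  have hsub : maxIndepIn G W ⊆
      ((maxIndepIn G W).filter (v₀ ∈ ·) ∪ (maxIndepIn G W).filter (a ∈ ·)) ∪
        (maxIndepIn G (W.erase a)).filter (b ∈ ·) := fun s hs => by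
    simp only [Finset.mem_union, Finset.mem_filter]
    by_cases has : a ∈ s
    · exact Or.inl (Or.inr ⟨hs, has⟩)
    by_cases hvs : v₀ ∈ s
    · exact Or.inl (Or.inl ⟨hs, hvs⟩)
    obtain ⟨x, hx, hxs⟩ := exists_mem_closedNbhd hs hv₀
    have hx' : x ∈ (closedNbhd G W v₀).erase v₀ :=
      Finset.mem_erase.2 ⟨fun h => hvs (h ▸ hxs), hx⟩
    rw [hN, Finset.mem_insert, Finset.mem_singleton] at hx'
    rcases hx' with rfl | rfl
    · exact absurd hxs has
    · exact Or.inr ⟨mem_maxIndepIn_erase hs has, hxs⟩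
  have h₄ : ((maxIndepIn G W).card : ℝ) ≤ _ := Nat.cast_le.2 <|
    (Finset.card_le_card hsub).trans <| (Finset.card_union_le _ _).trans <|
      add_le_add ((Finset.card_union_le _ _).trans <|
        add_le_add (card_filter_mem_le G W v₀) (card_filter_mem_le G W a))
        (card_filter_mem_le G (W.erase a) b)
  rw [hsd] at h₄
  push_cast at h₄
  have hpos : 0 ≤ √(2 : ℝ) ^ m := by positivity
  have e4 : √(2 : ℝ) ^ (m + 4) = √2 ^ m * 4 := by
    rw [pow_add, show √(2 : ℝ) ^ 4 = (√2 ^ 2) ^ 2 by ring, hr]; norm_num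
  rw [pow_succ] at h₁ h₂
  rw [e4]
  nlinarith

lemma isMaxIndep_iff_mem_maxIndepIn_univ [Fintype V] :
    IsMaxIndep G s ↔ s ∈ maxIndepIn G Finset.univ := by
  simp only [IsMaxIndep, mem_maxIndepIn, Finset.subset_univ, true_and, Finset.mem_univ,
    forall_const]
  refine and_congr_right fun hind => forall_congr' fun v => imp_congr_right fun _ => ?_
  constructor
  · intro h
    by_contra! hno
    refine h fun x hx y hy hxy => ?_
    rcases Finset.mem_insert.1 hx with rfl | hxs <;>
      rcases Finset.mem_insert.1 hy with rfl | hys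
    · exact G.loopless.irrefl _ hxy
    · exact hno y hys hxy
    · exact hno x hxs hxy.symm
    · exact hind x hxs y hys hxy
  · rintro ⟨y, hy, hvy⟩ h
    exact h v (Finset.mem_insert_self v s) y (Finset.mem_insert_of_mem hy) hvy

lemma MIS_eq_card_maxIndepIn_univ [Fintype V] (G : SimpleGraph V) :
    MIS G = (maxIndepIn G Finset.univ).card := by
  rw [MIS, ← Set.ncard_coe_finset]
  congr 1
  ext s
  exact isMaxIndep_iff_mem_maxIndepIn_univ

end

theorem stmt8 (V : Type*) [Fintype V] [DecidableEq V] (G : SimpleGraph V) (T : Finset V)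
    (hT : ∀ x y z : V, x ∉ T → y ∉ T → z ∉ T →
      G.Adj x y → G.Adj y z → G.Adj x z → False) :
    (MIS G : ℝ) ≤ (2 : ℝ) ^ ((Fintype.card V : ℝ) / 2 + (T.card : ℝ) / 2) := by
  rw [MIS_eq_card_maxIndepIn_univ]
  refine (card_maxIndepIn_le T hT (Fintype.card V + T.card) Finset.univ (by simp)).trans_eq ?_
  rw [Real.sqrt_eq_rpow, ← Real.rpow_mul_natCast (by norm_num)]
  congr 1
  push_cast
  ring
end

section
/- There exist δ > 0 and N such that for all n ≥ N the following holds: if A ⊆ [n] satisfies |A| ≤ 0.45n and A contains at most δn² Schur triples, then the number of maximal sum-free subsets of [n] that are contained in A is at most 2^{0.249n}. -/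
/-- A set of naturals is sum-free: no `x, y ∈ S` (not necessarily distinct) with `x + y ∈ S`. -/
def SumFree (S : Finset ℕ) : Prop := ∀ x ∈ S, ∀ y ∈ S, x + y ∉ S

/-- `S` is a maximal sum-free subset of `[n] = {1, …, n}`. -/
def IsMaxSumFree (n : ℕ) (S : Finset ℕ) : Prop :=
  S ⊆ Finset.Icc 1 n ∧ SumFree S ∧
    ∀ T : Finset ℕ, T ⊆ Finset.Icc 1 n → SumFree T → S ⊆ T → S = T

/-- The number of Schur triples in `A`: pairs `(x, y) ∈ A × A` with `x + y ∈ A`. -/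
def schurTriples (A : Finset ℕ) : ℕ :=
  ((A ×ˢ A).filter (fun p => p.1 + p.2 ∈ A)).card

/-- The number of maximal sum-free subsets of `[n]` that are contained in `A`. -/
noncomputable def fmaxIn (n : ℕ) (A : Finset ℕ) : ℕ :=
  {S : Finset ℕ | IsMaxSumFree n S ∧ S ⊆ A}.ncard

open Finset

/-- The independent subsets of `V` that dominate every other vertex of `V`, i.e. the maximal
independent sets of the graph induced on `V`. -/
noncomputable def maxIndepSets {α : Type*} [DecidableEq α] (G : SimpleGraph α) (V : Finset α) :
    Finset (Finset α) :=
  open Classical in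
  V.powerset.filter fun I =>
    (∀ u ∈ I, ∀ v ∈ I, ¬ G.Adj u v) ∧ ∀ v ∈ V, v ∉ I → ∃ u ∈ I, G.Adj u v

theorem mem_maxIndepSets {α : Type*} [DecidableEq α] {G : SimpleGraph α} {V I : Finset α} :
    I ∈ maxIndepSets G V ↔ I ⊆ V ∧ (∀ u ∈ I, ∀ v ∈ I, ¬ G.Adj u v) ∧
      ∀ v ∈ V, v ∉ I → ∃ u ∈ I, G.Adj u v := by
  simp [maxIndepSets]

theorem pow_three_le_three_pow (k : ℕ) : k ^ 3 ≤ 3 ^ k := by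
  rcases lt_or_ge k 3 with h | h
  · interval_cases k <;> norm_num
  · induction k, h using Nat.le_induction with
    | base => norm_num
    | succ k hk ih =>
      rw [pow_succ 3 k]
      nlinarith [mul_le_mul hk hk (by norm_num) (by omega)]

open Classical in
/-- The maximal independent sets through `u` correspond to maximal independent sets avoiding the
closed neighbourhood of `u`. -/
theorem card_maxIndepSets_filter_mem_le {α : Type*} [DecidableEq α] (G : SimpleGraph α)
    (V : Finset α) (u : α) :
    #{I ∈ maxIndepSets G V | u ∈ I} ≤ #(maxIndepSets G (V \ insert u (V.filter (G.Adj u)))) := by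
  refine card_le_card_of_injOn (fun I => I.erase u) ?_ ?_
  · intro I hI
    obtain ⟨hI, hu⟩ := mem_filter.1 hI
    obtain ⟨hV, hind, hmax⟩ := mem_maxIndepSets.1 hI
    refine mem_maxIndepSets.2 ⟨fun w hw => ?_, fun w hw z hz => ?_, fun w hw hwI => ?_⟩
    · obtain ⟨hne, hw⟩ := mem_erase.1 hw
      simp [hV hw, hne, hind u hu w hw]
    · exact hind w (mem_of_mem_erase hw) z (mem_of_mem_erase hz)
    · simp only [mem_sdiff, mem_insert, mem_filter, not_or, not_and] at hw
      obtain ⟨hwV, hwu, hadj⟩ := hw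
      obtain ⟨t, ht, htw⟩ := hmax w hwV fun h => hwI (mem_erase.2 ⟨hwu, h⟩)
      refine ⟨t, mem_erase.2 ⟨?_, ht⟩, htw⟩
      rintro rfl
      exact hadj hwV htw
  · intro I hI J hJ h
    have hI := (mem_filter.1 hI).2
    have hJ := (mem_filter.1 hJ).2
    rw [← insert_erase hI, ← insert_erase hJ]
    exact congrArg (insert u) h

/-- The **Moon–Moser bound**: a graph on `m` vertices has at most `3 ^ (m / 3)` maximal
independent sets. -/
theorem card_maxIndepSets_pow_three_le {α : Type*} [DecidableEq α] (G : SimpleGraph α)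
    (V : Finset α) : #(maxIndepSets G V) ^ 3 ≤ 3 ^ #V := by
  classical
  induction V using Finset.strongInduction with
  | H V ih =>
  rcases V.eq_empty_or_nonempty with rfl | hV
  · have : #(maxIndepSets G (∅ : Finset α)) ≤ 1 :=
      (card_le_card (filter_subset _ _)).trans (by simp)
    simpa using Nat.pow_le_pow_left this 3
  · let K : α → Finset α := fun u => insert u (V.filter (G.Adj u))
    have hKV : ∀ u ∈ V, K u ⊆ V := fun u hu => insert_subset hu (filter_subset _ _)
    obtain ⟨v, hv, hmin⟩ := V.exists_min_image (fun u => #(K u)) hV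
    let P : α → Finset (Finset α) := fun u => {I ∈ maxIndepSets G V | u ∈ I}
    obtain ⟨u, hu, hmax⟩ := (K v).exists_max_image (fun u => #(P u)) ⟨v, mem_insert_self _ _⟩
    have hcover : maxIndepSets G V ⊆ (K v).biUnion P := by
      intro I hI
      obtain ⟨hIV, hind, hdom⟩ := mem_maxIndepSets.1 hI
      by_cases hvI : v ∈ I
      · exact mem_biUnion.2 ⟨v, mem_insert_self _ _, mem_filter.2 ⟨hI, hvI⟩⟩
      · obtain ⟨w, hw, hwv⟩ := hdom v hv hvI
        exact mem_biUnion.2 ⟨w, mem_insert_of_mem (mem_filter.2 ⟨hIV hw, hwv.symm⟩),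
          mem_filter.2 ⟨hI, hw⟩⟩
    have hcard : #(maxIndepSets G V) ≤ #(K v) * #(P u) :=
      (card_le_card hcover).trans (card_biUnion_le_card_mul _ _ _ hmax)
    have huV := hKV v hv hu
    have hPu : #(P u) ^ 3 ≤ 3 ^ (#V - #(K v)) := by
      calc #(P u) ^ 3 ≤ #(maxIndepSets G (V \ K u)) ^ 3 :=
            Nat.pow_le_pow_left (card_maxIndepSets_filter_mem_le G V u) 3
        _ ≤ 3 ^ #(V \ K u) :=
            ih _ (sdiff_ssubset (hKV u huV) ⟨u, mem_insert_self _ _⟩)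
        _ ≤ 3 ^ (#V - #(K v)) := by
            rw [card_sdiff_of_subset (hKV u huV)]
            exact Nat.pow_le_pow_right (by norm_num) (Nat.sub_le_sub_left (hmin u huV) _)
    calc #(maxIndepSets G V) ^ 3 ≤ (#(K v) * #(P u)) ^ 3 := Nat.pow_le_pow_left hcard 3
      _ = #(K v) ^ 3 * #(P u) ^ 3 := mul_pow _ _ _
      _ ≤ 3 ^ #(K v) * 3 ^ (#V - #(K v)) := Nat.mul_le_mul (pow_three_le_three_pow _) hPu
      _ = 3 ^ #V := by rw [← pow_add, Nat.add_sub_cancel' (card_le_card (hKV v hv))]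

theorem SumFree.subset {S T : Finset ℕ} (hS : SumFree S) (h : T ⊆ S) : SumFree T :=
  fun x hx y hy hxy => hS x (h hx) y (h hy) (h hxy)

/-- The link graph of `T`: two numbers are joined if they complete `T` to a set that is not
sum-free. -/
def sumLink (T : Finset ℕ) : SimpleGraph ℕ :=
  SimpleGraph.fromRel fun x y => ¬ SumFree (insert x (insert y T))

theorem sumLink_adj {T : Finset ℕ} {x y : ℕ} :
    (sumLink T).Adj x y ↔ x ≠ y ∧ ¬ SumFree (insert x (insert y T)) := by
  simp [sumLink, Finset.insert_comm y x]

open Classical in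
/-- The part in `B` of a maximal sum-free set is a maximal independent set in a link graph. -/
theorem IsMaxSumFree.sdiff_mem_maxIndepSets {n : ℕ} {S T B : Finset ℕ} (hS : IsMaxSumFree n S)
    (hB : SumFree B) (hBn : B ⊆ Icc 1 n) (hTS : T ⊆ S) (hSB : S \ T ⊆ B)
    (hTB : Disjoint T B) :
    S \ T ∈ maxIndepSets (sumLink T) {v ∈ B | SumFree (insert v T)} := by
  obtain ⟨hSn, hSf, hmax⟩ := hS
  refine mem_maxIndepSets.2 ⟨fun v hv => mem_filter.2 ⟨hSB hv, hSf.subset ?_⟩, ?_, ?_⟩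
  · exact insert_subset (mem_sdiff.1 hv).1 hTS
  · intro u hu v hv h
    exact (sumLink_adj.1 h).2 (hSf.subset (insert_subset (mem_sdiff.1 hu).1
      (insert_subset (mem_sdiff.1 hv).1 hTS)))
  · intro v hv hvI
    obtain ⟨hvB, hvT⟩ := mem_filter.1 hv
    by_contra! hcon
    have hlink : ∀ x y, (x = v ∨ x ∈ S \ T) → (y = v ∨ y ∈ S \ T) →
        SumFree (insert x (insert y T)) := by
      have key : ∀ x ∈ S \ T, SumFree (insert x (insert v T)) := by
        intro x hx
        by_contra h
        exact hcon x hx (sumLink_adj.2 ⟨fun hxv => hvI (hxv ▸ hx), h⟩)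
      rintro x y (rfl | hx) (rfl | hy)
      · simpa using hvT
      · rw [Finset.insert_comm]; exact key y hy
      · exact key x hx
      · exact hSf.subset (insert_subset (mem_sdiff.1 hx).1
          (insert_subset (mem_sdiff.1 hy).1 hTS))
    have hfree : SumFree (insert v S) := by
      have hcase : ∀ x ∈ insert v S, x ∈ T ∨ (x = v ∨ x ∈ S \ T) := by
        intro x hx
        simp only [mem_insert, mem_sdiff] at hx ⊢
        tauto
      have hinB : ∀ x, (x = v ∨ x ∈ S \ T) → x ∈ B := by
        rintro x (rfl | hx)
        exacts [hvB, hSB hx]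
      intro x hx y hy hxy
      rcases hcase x hx with hx | hx <;> rcases hcase y hy with hy | hy <;>
        rcases hcase _ hxy with hz | hz
      · exact hlink v v (.inl rfl) (.inl rfl) x (by simp [hx]) y (by simp [hy]) (by simp [hz])
      · exact hlink _ _ hz hz x (by simp [hx]) y (by simp [hy]) (by simp)
      · exact hlink _ _ hy hy x (by simp [hx]) y (by simp) (by simp [hz])
      · exact hlink _ _ hy hz x (by simp [hx]) y (by simp) (by simp)
      · exact hlink _ _ hx hx x (by simp) y (by simp [hy]) (by simp [hz])
      · exact hlink _ _ hx hz x (by simp) y (by simp [hy]) (by simp)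
      · exact hlink _ _ hx hy x (by simp) y (by simp) (by simp [hz])
      · exact hB x (hinB x hx) y (hinB y hy) (hinB _ hz)
    have hvS : v ∈ S := by
      rw [hmax _ (insert_subset (hBn hvB) hSn) hfree (subset_insert v S)]
      exact mem_insert_self v S
    exact hvI (mem_sdiff.2 ⟨hvS, disjoint_right.1 hTB hvB⟩)

open Classical in
/-- Splitting `A` into a sum-free part and a remainder `C` bounds the number of maximal sum-free
subsets of `[n]` in `A`. -/
theorem fmaxIn_le {n : ℕ} {A C : Finset ℕ} (hA : A ⊆ Icc 1 n) (hfree : SumFree (A \ C)) {m : ℕ}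
    (hm : ∀ k, k ^ 3 ≤ 3 ^ #A → k ≤ m) : fmaxIn n A ≤ 2 ^ #C * m := by
  let B := A \ C
  let F : Finset (Finset ℕ) := {S ∈ A.powerset | IsMaxSumFree n S}
  have hF : fmaxIn n A = #F := by
    rw [fmaxIn, ← Set.ncard_coe_finset]
    congr 1
    ext S
    simp [F, and_comm]
  rw [hF, ← card_powerset, mul_comm]
  refine card_le_mul_card_image_of_maps_to (f := fun S => S ∩ C)
    (fun S _ => mem_powerset.2 inter_subset_right) m fun T hT => hm _ ?_
  have hTB : Disjoint T B := disjoint_sdiff.mono_left (mem_powerset.1 hT)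
  have hle : #{S ∈ F | S ∩ C = T} ≤
      #(maxIndepSets (sumLink T) {v ∈ B | SumFree (insert v T)}) := by
    refine card_le_card_of_injOn (fun S => S \ T) ?_ ?_
    · intro S hS
      obtain ⟨hSF, rfl⟩ := mem_filter.1 hS
      obtain ⟨hSA, hSm⟩ := mem_filter.1 hSF
      refine IsMaxSumFree.sdiff_mem_maxIndepSets hSm hfree (sdiff_subset.trans hA)
        inter_subset_left ?_ hTB
      rw [sdiff_inter_self_left]
      exact sdiff_subset_sdiff (mem_powerset.1 hSA) subset_rfl
    · intro S hS R hR h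
      have hS : T ⊆ S := (mem_filter.1 hS).2 ▸ inter_subset_left
      have hR : T ⊆ R := (mem_filter.1 hR).2 ▸ inter_subset_left
      rw [← sdiff_union_of_subset hS, ← sdiff_union_of_subset hR]
      exact congrArg (· ∪ T) h
  calc #{S ∈ F | S ∩ C = T} ^ 3 ≤ _ := Nat.pow_le_pow_left hle 3
    _ ≤ 3 ^ #{v ∈ B | SumFree (insert v T)} := card_maxIndepSets_pow_three_le _ _
    _ ≤ 3 ^ #A := Nat.pow_le_pow_right (by norm_num)
      (card_le_card ((filter_subset _ _).trans sdiff_subset))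

/-- The graph on `{0, …, m - 1}` joining numbers whose difference lies in `A`. -/
def differenceGraph (A : Finset ℕ) (m : ℕ) : SimpleGraph (Fin m) :=
  SimpleGraph.fromRel fun x y => ∃ a ∈ A, (x : ℕ) + a = y

theorem differenceGraph_adj {A : Finset ℕ} {m : ℕ} {x y : Fin m} :
    (differenceGraph A m).Adj x y ↔
      x ≠ y ∧ ((∃ a ∈ A, (x : ℕ) + a = y) ∨ ∃ a ∈ A, (y : ℕ) + a = x) := by
  simp [differenceGraph]

open Classical in
theorem card_cliqueFinset_differenceGraph_le (A : Finset ℕ) (m : ℕ) :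
    #((differenceGraph A m).cliqueFinset 3) ≤ m * schurTriples A := by
  let P := range m ×ˢ (A ×ˢ A).filter fun p => p.1 + p.2 ∈ A
  let f : ℕ × ℕ × ℕ → Finset ℕ := fun p => {p.1, p.1 + p.2.1, p.1 + p.2.1 + p.2.2}
  have hP : #P = m * schurTriples A := by
    rw [card_product, card_range, schurTriples]
  rw [← hP]
  refine le_trans (card_le_card_of_injOn (t := P.image f) (fun s => s.map Fin.valEmbedding) ?_
    (map_injective _).injOn) card_image_le
  intro s hs
  obtain ⟨x, y, z, hxy, hxz, hyz, rfl⟩ :=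
    SimpleGraph.is3Clique_iff.1 (SimpleGraph.mem_cliqueFinset_iff.1 hs)
  have key : ∀ x < m, ∀ a ∈ A, ∀ b ∈ A, ∀ c ∈ A, ∀ s : Finset ℕ, x + a + b = x + c →
      s = {x, x + a, x + a + b} → s ∈ P.image f := by
    rintro x hx a ha b hb c hc s h rfl
    have : a + b = c := by omega
    subst this
    exact mem_image.2 ⟨(x, a, b), by simp [P, hx, ha, hb, hc], rfl⟩
  have hx := x.isLt
  have hy := y.isLt
  have hz := z.isLt
  simp only [map_insert, map_singleton, Fin.valEmbedding_apply]
  rcases (differenceGraph_adj.1 hxy).2 with ⟨a, ha, h1⟩ | ⟨a, ha, h1⟩ <;>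
  rcases (differenceGraph_adj.1 hxz).2 with ⟨b, hb, h2⟩ | ⟨b, hb, h2⟩ <;>
  rcases (differenceGraph_adj.1 hyz).2 with ⟨c, hc, h3⟩ | ⟨c, hc, h3⟩
  · exact key _ hx a ha c hc b hb _ (by omega)
      (by ext t; simp only [mem_insert, mem_singleton]; omega)
  · exact key _ hx b hb c hc a ha _ (by omega)
      (by ext t; simp only [mem_insert, mem_singleton]; omega)
  · exact absurd (Fin.ext (by omega)) hxy.ne
  · exact key _ hz b hb a ha c hc _ (by omega)
      (by ext t; simp only [mem_insert, mem_singleton]; omega)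
  · exact key _ hy a ha b hb c hc _ (by omega)
      (by ext t; simp only [mem_insert, mem_singleton]; omega)
  · exact absurd (Fin.ext (by omega)) hxy.ne
  · exact key _ hy c hc b hb a ha _ (by omega)
      (by ext t; simp only [mem_insert, mem_singleton]; omega)
  · exact key _ hz c hc a ha b hb _ (by omega)
      (by ext t; simp only [mem_insert, mem_singleton]; omega)

open Classical in
/-- A form of **Green's removal lemma** for the Schur equation in the integers. -/
theorem exists_sumFree_sdiff {ε : ℝ} {n : ℕ} (hn : 0 < n) {A : Finset ℕ} (hA : A ⊆ Icc 1 n)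
    (h : (schurTriples A : ℝ) < SimpleGraph.triangleRemovalBound ε * n ^ 2) :
    ∃ C : Finset ℕ, (#C : ℝ) ≤ 27 * ε * n ∧ SumFree (A \ C) := by
  have hpos : ∀ a ∈ A, 0 < a := fun a ha => (mem_Icc.1 (hA ha)).1
  have hle : ∀ a ∈ A, a ≤ n := fun a ha => (mem_Icc.1 (hA ha)).2
  let G := differenceGraph A (3 * n)
  have hn' : (0 : ℝ) < n := by exact_mod_cast hn
  have htri : (#(G.cliqueFinset 3) : ℝ) <
      SimpleGraph.triangleRemovalBound ε * Fintype.card (Fin (3 * n)) ^ 3 := by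
    have h1 : (#(G.cliqueFinset 3) : ℝ) ≤ 3 * n * schurTriples A := by
      exact_mod_cast card_cliqueFinset_differenceGraph_le A (3 * n)
    have h2 : 3 * n * (schurTriples A : ℝ) <
        3 * n * (SimpleGraph.triangleRemovalBound ε * n ^ 2) := by gcongr
    have h0 : 0 ≤ SimpleGraph.triangleRemovalBound ε * n ^ 2 := (Nat.cast_nonneg _).trans h.le
    rw [Fintype.card_fin]
    push_cast
    nlinarith [mul_nonneg hn'.le h0]
  obtain ⟨G', hG', _, hcard, hfree⟩ := SimpleGraph.triangle_removal htri
  let R : ℕ → Finset (Fin (3 * n) × Fin (3 * n)) := fun a =>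
    {p | (p.1 : ℕ) + a = p.2 ∧ ¬ G'.Adj p.1 p.2}
  let C : Finset ℕ := {a ∈ A | n ≤ 3 * #(R a)}
  refine ⟨C, ?_, ?_⟩
  · have hdisj : (C : Set ℕ).PairwiseDisjoint R := by
      intro a _ b _ hab
      refine disjoint_left.2 fun p hp hq => hab ?_
      have h1 := (mem_filter.1 hp).2.1
      have h2 := (mem_filter.1 hq).2.1
      omega
    have hRlt : ∀ p ∈ C.biUnion R, p.1 < p.2 ∧ G.Adj p.1 p.2 ∧ ¬ G'.Adj p.1 p.2 := by
      intro p hp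
      obtain ⟨a, ha, hp⟩ := mem_biUnion.1 hp
      have haA := (mem_filter.1 ha).1
      obtain ⟨-, h1, h2⟩ := mem_filter.1 hp
      have hlt : p.1 < p.2 := Fin.lt_def.2 (by have := hpos a haA; omega)
      exact ⟨hlt, differenceGraph_adj.2 ⟨hlt.ne, .inl ⟨a, haA, h1⟩⟩, h2⟩
    have hbU : #(C.biUnion R) ≤ #(G.edgeFinset \ G'.edgeFinset) := by
      refine card_le_card_of_injOn (fun p => s(p.1, p.2)) ?_ ?_
      · intro p hp
        obtain ⟨-, h1, h2⟩ := hRlt p hp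
        simp [h1, h2]
      · rintro ⟨x, y⟩ hp ⟨z, w⟩ hq h
        have h1 := (hRlt _ hp).1
        have h2 := (hRlt _ hq).1
        simp only [Sym2.eq_iff] at h
        rcases h with ⟨rfl, rfl⟩ | ⟨rfl, rfl⟩
        · rfl
        · exact absurd h1 h2.asymm
    have hsub : G'.edgeFinset ⊆ G.edgeFinset := SimpleGraph.edgeFinset_subset_edgeFinset.2 hG'
    have hcount : #C * n ≤ 3 * #(G.edgeFinset \ G'.edgeFinset) := by
      calc #C * n ≤ ∑ a ∈ C, 3 * #(R a) :=
            card_nsmul_le_sum C _ n fun a ha => (mem_filter.1 ha).2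
        _ = 3 * #(C.biUnion R) := by rw [card_biUnion hdisj, mul_sum]
        _ ≤ _ := by gcongr
    have hcount' : (#C : ℝ) * n ≤ 3 * (#G.edgeFinset - #G'.edgeFinset) := by
      rw [card_sdiff_of_subset hsub] at hcount
      rw [← Nat.cast_sub (card_le_card hsub)]
      exact_mod_cast hcount
    rw [Fintype.card_fin] at hcard
    push_cast at hcard
    refine le_of_mul_le_mul_right ?_ hn'
    linarith
  · intro a ha b hb hab
    have hR : ∀ c ∈ A \ C, 3 * #(R c) < n := by
      intro c hc
      obtain ⟨hcA, hc⟩ := mem_sdiff.1 hc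
      by_contra! h
      exact hc (mem_filter.2 ⟨hcA, h⟩)
    have han := hle a (mem_sdiff.1 ha).1
    have hbn := hle b (mem_sdiff.1 hb).1
    let p : Fin n → Fin (3 * n) := fun x => ⟨x, by omega⟩
    let q : Fin n → Fin (3 * n) := fun x => ⟨x + a, by omega⟩
    let r : Fin n → Fin (3 * n) := fun x => ⟨x + a + b, by omega⟩
    let U : Finset (Fin n) := {x | (p x, q x) ∈ R a}
    let V : Finset (Fin n) := {x | (q x, r x) ∈ R b}
    let W : Finset (Fin n) := {x | (p x, r x) ∈ R (a + b)}
    have hcover : univ ⊆ (U ∪ V) ∪ W := by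
      intro x _
      by_contra hx
      simp only [mem_union, mem_filter, mem_univ, true_and, not_or, U, V, W, R, p, q, r,
        not_not, add_assoc] at hx
      exact hfree _ (SimpleGraph.is3Clique_iff.2
        ⟨p x, q x, r x, hx.1.1, by simpa [r, add_assoc] using hx.2,
          by simpa [r, add_assoc] using hx.1.2, rfl⟩)
    have hp : Function.Injective p := fun x y h => by simpa [p, Fin.ext_iff] using h
    have hq : Function.Injective q := fun x y h => by simpa [q, Fin.ext_iff] using h
    have h1 : #U ≤ #(R a) :=
      card_le_card_of_injOn (fun x => (p x, q x)) (fun x hx => (mem_filter.1 hx).2)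
        fun x _ y _ h => hp (Prod.ext_iff.1 h).1
    have h2 : #V ≤ #(R b) :=
      card_le_card_of_injOn (fun x => (q x, r x)) (fun x hx => (mem_filter.1 hx).2)
        fun x _ y _ h => hq (Prod.ext_iff.1 h).1
    have h3 : #W ≤ #(R (a + b)) :=
      card_le_card_of_injOn (fun x => (p x, r x)) (fun x hx => (mem_filter.1 hx).2)
        fun x _ y _ h => hp (Prod.ext_iff.1 h).1
    have h4 := card_le_card hcover
    have h5 := card_union_le (U ∪ V) W
    have h6 := card_union_le U V
    rw [card_univ, Fintype.card_fin] at h4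
    have := hR a ha
    have := hR b hb
    have := hR _ hab
    omega

theorem three_rpow_le_two_rpow {x : ℝ} (hx : 0 ≤ x) :
    (3 : ℝ) ^ (0.15 * x) ≤ 2 ^ (0.239 * x) := by
  rw [Real.rpow_mul (by norm_num), Real.rpow_mul (by norm_num)]
  refine Real.rpow_le_rpow (by positivity) ?_ hx
  refine le_of_pow_le_pow_left₀ (n := 1000) (by norm_num) (by positivity) ?_
  rw [← Real.rpow_mul_natCast (by norm_num), ← Real.rpow_mul_natCast (by norm_num)]
  norm_num

theorem stmt11 :
    ∃ δ : ℝ, 0 < δ ∧ ∃ N : ℕ, ∀ n : ℕ, N ≤ n →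
      ∀ A : Finset ℕ, A ⊆ Finset.Icc 1 n →
        (A.card : ℝ) ≤ 0.45 * n →
        (schurTriples A : ℝ) ≤ δ * n ^ 2 →
        (fmaxIn n A : ℝ) ≤ (2 : ℝ) ^ (0.249 * (n : ℝ)) := by
  have hε : (0 : ℝ) < 1 / 2700 := by norm_num
  have hδ := SimpleGraph.triangleRemovalBound_pos hε
  refine ⟨SimpleGraph.triangleRemovalBound (1 / 2700) / 2, by positivity, 1,
    fun n hn A hA hcard hschur => ?_⟩
  have hn' : (0 : ℝ) < n := by exact_mod_cast hn
  obtain ⟨C, hC, hfree⟩ := exists_sumFree_sdiff (ε := 1 / 2700) hn hA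
    (hschur.trans_lt (by gcongr; linarith))
  have hm : ∀ k : ℕ, k ^ 3 ≤ 3 ^ #A → k ≤ ⌊(2 : ℝ) ^ (0.239 * (n : ℝ))⌋₊ := by
    intro k hk
    refine Nat.le_floor (le_trans ?_ (three_rpow_le_two_rpow hn'.le))
    refine le_of_pow_le_pow_left₀ (n := 3) (by norm_num) (by positivity) ?_
    calc (k : ℝ) ^ 3 ≤ (3 : ℝ) ^ (#A : ℝ) := by
          rw [Real.rpow_natCast]
          exact_mod_cast hk
      _ ≤ 3 ^ (0.45 * (n : ℝ)) := Real.rpow_le_rpow_of_exponent_le (by norm_num) hcard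
      _ = ((3 : ℝ) ^ (0.15 * (n : ℝ))) ^ 3 := by
          rw [← Real.rpow_mul_natCast (by norm_num)]
          congr 1
          push_cast
          ring
  calc (fmaxIn n A : ℝ) ≤ 2 ^ #C * (⌊(2 : ℝ) ^ (0.239 * (n : ℝ))⌋₊ : ℝ) := by
        exact_mod_cast fmaxIn_le hA hfree hm
    _ ≤ (2 : ℝ) ^ (0.01 * (n : ℝ)) * 2 ^ (0.239 * (n : ℝ)) := by
        gcongr
        · rw [← Real.rpow_natCast]
          exact Real.rpow_le_rpow_of_exponent_le (by norm_num) (by linarith)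
        · exact Nat.floor_le (by positivity)
    _ = (2 : ℝ) ^ (0.249 * (n : ℝ)) := by
        rw [← Real.rpow_add (by norm_num)]
        congr 1
        ring
end
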